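/- For every n ∈ ℕ, the unitary group U(n) is algebraically closed with respect to one-variable equations: every non-singular equation w ∈ U(n) * F₁ in one variable with coefficients in U(n) (i.e., with content ε(w) ≠ 1 in F₁ ≅ ℤ) can be solved in U(n), i.e., there exists u ∈ U(n) such that the image of w under the homomorphism U(n) * F₁ → U(n) restricting to the identity on U(n) and sending the free generator to u is trivial. -/

import Mathlib

/-- The content homomorphism `Γ ∗ F₁ → F₁`, killing the coefficients. -/
def contentHom₁ (Γ : Type*) [Group Γ] :
    Monoid.Coprod Γ (FreeGroup (Fin 1)) →* FreeGroup (Fin 1) :=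
  Monoid.Coprod.lift 1 (MonoidHom.id _)

open scoped ContDiff Topology
open VectorField

theorem Finset.sum_sum_eq_zero_of_antisymm {ι : Type*} [Fintype ι] {a : ι → ι → ℝ}
    (h : ∀ i j, a i j + a j i = 0) :
    ∑ i, ∑ j, a i j = 0 := by
  have h1 : ∑ i, ∑ j, (a i j + a j i) = 0 := by simp [h]
  simp only [Finset.sum_add_distrib] at h1
  rw [Finset.sum_comm (f := fun i j => a j i)] at h1
  linarith

/-- Exchanging the two modified slots of an alternating map changes its sign. -/
theorem AlternatingMap.map_update_update_swap {ι E : Type*} [DecidableEq ι] [AddCommGroup E]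
    [Module ℝ E] (vol : E [⋀^ι]→ₗ[ℝ] ℝ) (v : ι → E) {j k : ι}
    (hjk : j ≠ k) (x y : E) :
    vol (Function.update (Function.update v k x) j y) =
      - vol (Function.update (Function.update v j x) k y) := by
  rw [← vol.map_swap _ hjk]
  congr 1
  funext i
  by_cases hj : i = j
  · subst hj; simp
  by_cases hk : i = k
  · subst hk; simp [hjk.symm, hjk]
  simp [Equiv.swap_apply_of_ne_of_ne hj hk, hj, hk]

section Piola

variable {ι P E : Type*} [Fintype ι] [DecidableEq ι]
  [NormedAddCommGroup P] [NormedSpace ℝ P] [NormedAddCommGroup E] [NormedSpace ℝ E]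

theorem ContinuousAlternatingMap.fderiv_comp_apply (vol : E [⋀^ι]→L[ℝ] ℝ) {g : ι → P → E} {p : P}
    (hg : ∀ i, DifferentiableAt ℝ (g i) p) (v : P) :
    fderiv ℝ (fun x => vol (fun i => g i x)) p v =
      ∑ i, vol (Function.update (fun i => g i p) i (fderiv ℝ (g i) p v)) := by
  have := HasFDerivAt.multilinear_comp vol.toContinuousMultilinearMap
    (fun i => (hg i).hasFDerivAt)
  have h2 : HasFDerivAt (fun x => vol (fun i => g i x)) _ p := this
  rw [h2.fderiv]
  simp

/-- A Piola identity: the divergence of the vector field obtained from the Jacobian of `h` along a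
unimodular frame `V` by replacing each direction in turn by `T` is the derivative along `T` of the
Jacobian. -/
theorem sum_fderiv_vol_update_eq (vol : E [⋀^ι]→L[ℝ] ℝ) {h : P → E} {V : ι → P → P} {T : P → P}
    (hh : ContDiff ℝ ∞ h) (hV : ∀ j, ContDiff ℝ ∞ (V j)) (hT : ContDiff ℝ ∞ T) {p : P}
    (hTV : ∀ j, lieBracket ℝ T (V j) p = 0)
    (hVV : ∀ j k, ∃ c : ι → ℝ, c j = 0 ∧ c k = 0 ∧
      lieBracket ℝ (V j) (V k) p = ∑ l, c l • V l p) :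
    ∑ j, fderiv ℝ (fun x => vol (Function.update (fun i => fderiv ℝ h x (V i x)) j
        (fderiv ℝ h x (T x)))) p (V j p) =
      fderiv ℝ (fun x => vol (fun i => fderiv ℝ h x (V i x))) p (T p) := by
  have hd : ContDiff ℝ ∞ (fderiv ℝ h) := hh.fderiv_right (by simp)
  have hg : ∀ j, ContDiff ℝ ∞ (fun x => fderiv ℝ h x (V j x)) := fun j => hd.clm_apply (hV j)
  have hξ : ContDiff ℝ ∞ (fun x => fderiv ℝ h x (T x)) := hd.clm_apply hT
  have bracket : ∀ {W W' : P → P}, ContDiff ℝ ∞ W → ContDiff ℝ ∞ W' →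
      fderiv ℝ h p (lieBracket ℝ W W' p) =
        fderiv ℝ (fun x ↦ fderiv ℝ h x (W' x)) p (W p) -
        fderiv ℝ (fun x ↦ fderiv ℝ h x (W x)) p (W' p) := fun hW hW' =>
    fderiv_apply_lieBracket hh.contDiffAt (by simpa using ENat.LEInfty.out)
      (hW'.differentiable (by simp) p) (hW.differentiable (by simp) p)
  rw [ContinuousAlternatingMap.fderiv_comp_apply vol (fun i => (hg i).differentiable (by simp) p)]
  set a : ι → ι → ℝ := fun j k => if k = j then 0 else
    vol (Function.update (Function.update (fun i => fderiv ℝ h p (V i p)) j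
      (fderiv ℝ h p (T p))) k (fderiv ℝ (fun x => fderiv ℝ h x (V k x)) p (V j p))) with ha
  have key : ∀ j, fderiv ℝ (fun x => vol (Function.update (fun i => fderiv ℝ h x (V i x)) j
        (fderiv ℝ h x (T x)))) p (V j p) =
      vol (Function.update (fun i => fderiv ℝ h p (V i p)) j
        (fderiv ℝ (fun x => fderiv ℝ h x (V j x)) p (T p))) + ∑ k, a j k := by
    intro j
    have e : (fun x => vol (Function.update (fun i => fderiv ℝ h x (V i x)) j
        (fderiv ℝ h x (T x)))) = fun x => vol (fun i =>
        Function.update (fun i x => fderiv ℝ h x (V i x)) j (fun x => fderiv ℝ h x (T x)) i x) := by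
      funext x
      congr 1
      funext i
      by_cases hi : i = j
      · subst hi; simp
      · simp [hi]
    have hgu : ∀ i, DifferentiableAt ℝ (Function.update (fun i x => fderiv ℝ h x (V i x)) j
        (fun x => fderiv ℝ h x (T x)) i) p := by
      intro i
      by_cases hi : i = j
      · subst hi; simpa using hξ.differentiable (by simp) p
      · simpa [hi] using (hg i).differentiable (by simp) p
    have e' : (fun i => Function.update (fun i x => fderiv ℝ h x (V i x)) j
        (fun x => fderiv ℝ h x (T x)) i p) = Function.update (fun i => fderiv ℝ h p (V i p)) j
        (fderiv ℝ h p (T p)) := by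
      funext i
      by_cases hi : i = j
      · subst hi; simp
      · simp [hi]
    rw [e, ContinuousAlternatingMap.fderiv_comp_apply vol hgu, e',
      ← Finset.add_sum_erase _ _ (Finset.mem_univ j),
      ← Finset.add_sum_erase _ (a j) (Finset.mem_univ j)]
    have b := bracket hT (hV j)
    rw [hTV, map_zero, eq_comm, sub_eq_zero] at b
    simp only [Function.update_self, Function.update_idem, b, ha, if_true, zero_add]
    congr 1
    refine Finset.sum_congr rfl fun k hk => ?_
    have hk' : k ≠ j := Finset.ne_of_mem_erase hk
    simp [hk']
  rw [Finset.sum_congr rfl (fun j _ => key j), Finset.sum_add_distrib,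
    Finset.sum_sum_eq_zero_of_antisymm, add_zero]
  intro j k
  by_cases hjk : j = k
  · simp [ha, hjk]
  simp only [ha, hjk, Ne.symm hjk, if_false]
  obtain ⟨c, hcj, hck, hc⟩ := hVV j k
  have b := bracket (hV j) (hV k)
  rw [hc, map_sum] at b
  have sw := AlternatingMap.map_update_update_swap vol.toAlternatingMap
    (fun i => fderiv ℝ h p (V i p)) hjk (fderiv ℝ h p (T p))
    (fderiv ℝ (fun x => fderiv ℝ h x (V j x)) p (V k p))
  simp only [ContinuousAlternatingMap.coe_toAlternatingMap] at sw
  rw [sw, ← sub_eq_add_neg, ← ContinuousAlternatingMap.map_update_sub, ← b]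
  rw [← ContinuousAlternatingMap.coe_toAlternatingMap, AlternatingMap.map_update_sum]
  refine Finset.sum_eq_zero fun l _ => ?_
  by_cases hlj : l = j
  · simp [hlj, hcj, (AlternatingMap.map_update_zero)]
  by_cases hlk : l = k
  · simp [hlk, hck, (AlternatingMap.map_update_zero)]
  rw [map_smul, AlternatingMap.map_update_smul,
    vol.toAlternatingMap.map_eq_zero_of_eq _ (i := k) (j := l) (by simp [hlj, hlk]) (Ne.symm hlk),
    smul_zero]

/-- `Matrix.detRowAlternating` as a continuous alternating map. -/
noncomputable def Matrix.detRowAlternatingL (ι : Type*) [Fintype ι] [DecidableEq ι] :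
    (ι → ℝ) [⋀^ι]→L[ℝ] ℝ :=
  { (Matrix.detRowAlternating : (ι → ℝ) [⋀^ι]→ₗ[ℝ] ℝ) with
    cont := Continuous.matrix_det (A := fun M : ι → ι → ℝ => Matrix.of M) continuous_id }

theorem Matrix.detRowAlternatingL_apply (M : ι → ι → ℝ) :
    Matrix.detRowAlternatingL ι M = (Matrix.of M).det := rfl

/-- Cramer's rule. -/
theorem Matrix.sum_detRowAlternatingL_update_smul (M : ι → ι → ℝ) (y : ι → ℝ) :
    ∑ j, Matrix.detRowAlternatingL ι (Function.update M j y) • M j =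
      Matrix.detRowAlternatingL ι M • y := by
  have h := Matrix.mulVec_cramer (Matrix.of M).transpose y
  rw [Matrix.det_transpose] at h
  rw [Matrix.detRowAlternatingL_apply, ← h]
  funext i
  simp only [Finset.sum_apply, Pi.smul_apply, smul_eq_mul, Matrix.mulVec, dotProduct,
    Matrix.cramer_transpose_apply, Matrix.transpose_apply, Matrix.of_apply]
  exact Finset.sum_congr rfl fun j _ => mul_comm _ _

theorem ContDiff.frame_det {h : P → (ι → ℝ)} {ρ : P → ℝ} {V : ι → P → P}
    (hh : ContDiff ℝ ∞ h) (hρ : ContDiff ℝ ∞ ρ) (hV : ∀ j, ContDiff ℝ ∞ (V j)) :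
    ContDiff ℝ ∞ fun x => ρ x * Matrix.detRowAlternatingL ι (fun i => fderiv ℝ h x (V i x)) :=
  hρ.mul ((Matrix.detRowAlternatingL ι).toContinuousMultilinearMap.contDiff.comp
    (contDiff_pi.2 fun j => (hh.fderiv_right (by simp)).clm_apply (hV j)))

theorem ContDiff.frame_det_update {h : P → (ι → ℝ)} {ρ : P → ℝ} {V : ι → P → P} {T : P → P}
    (hh : ContDiff ℝ ∞ h) (hρ : ContDiff ℝ ∞ ρ) (hV : ∀ j, ContDiff ℝ ∞ (V j))
    (hT : ContDiff ℝ ∞ T) (j : ι) :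
    ContDiff ℝ ∞ fun x => ρ x * Matrix.detRowAlternatingL ι
      (Function.update (fun i => fderiv ℝ h x (V i x)) j (fderiv ℝ h x (T x))) := by
  have hd : ContDiff ℝ ∞ (fderiv ℝ h) := hh.fderiv_right (by simp)
  refine hρ.mul ((Matrix.detRowAlternatingL ι).toContinuousMultilinearMap.contDiff.comp
    (contDiff_pi.2 fun i => ?_))
  by_cases hi : i = j
  · subst hi; simpa using hd.clm_apply hT
  · simpa [hi] using hd.clm_apply (hV i)

/-- The weighted Piola identity for a weight `ρ` whose derivative factors through that of `h`. -/
theorem sum_fderiv_weight_mul_det_update_eq {h : P → (ι → ℝ)} {ρ : P → ℝ} {V : ι → P → P}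
    {T : P → P} (hh : ContDiff ℝ ∞ h) (hρ : ContDiff ℝ ∞ ρ) (hV : ∀ j, ContDiff ℝ ∞ (V j))
    (hT : ContDiff ℝ ∞ T) {p : P}
    (hTV : ∀ j, lieBracket ℝ T (V j) p = 0)
    (hVV : ∀ j k, ∃ c : ι → ℝ, c j = 0 ∧ c k = 0 ∧
      lieBracket ℝ (V j) (V k) p = ∑ l, c l • V l p)
    (hρh : ∃ ℓ : (ι → ℝ) →ₗ[ℝ] ℝ, fderiv ℝ ρ p (T p) = ℓ (fderiv ℝ h p (T p)) ∧
      ∀ j, fderiv ℝ ρ p (V j p) = ℓ (fderiv ℝ h p (V j p))) :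
    ∑ j, fderiv ℝ (fun x => ρ x * Matrix.detRowAlternatingL ι
        (Function.update (fun i => fderiv ℝ h x (V i x)) j (fderiv ℝ h x (T x)))) p (V j p) =
      fderiv ℝ (fun x => ρ x * Matrix.detRowAlternatingL ι (fun i => fderiv ℝ h x (V i x)))
        p (T p) := by
  have hg := ContDiff.frame_det hh contDiff_const (ρ := fun _ => 1) hV
  have hu := ContDiff.frame_det_update hh contDiff_const (ρ := fun _ => 1) hV hT
  simp only [one_mul] at hg hu
  have dρ := hρ.differentiable (by simp) p
  have mul : ∀ {f : P → ℝ}, ContDiff ℝ ∞ f → ∀ v, fderiv ℝ (fun x => ρ x * f x) p v =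
      ρ p * fderiv ℝ f p v + f p * fderiv ℝ ρ p v := by
    intro f hf v
    rw [fderiv_fun_mul dρ (hf.differentiable (by simp) p)]
    simp
  obtain ⟨ℓ, hℓT, hℓV⟩ := hρh
  refine (Finset.sum_congr rfl fun j _ => mul (hu j) (V j p)).trans
    (Eq.trans ?_ (mul hg _).symm)
  rw [Finset.sum_add_distrib, ← Finset.mul_sum]
  have hP := sum_fderiv_vol_update_eq (Matrix.detRowAlternatingL ι) hh hV hT hTV hVV
  rw [hP, hℓT]
  congr 1
  simp only [hℓV]
  rw [← smul_eq_mul, ← map_smul, ← Matrix.sum_detRowAlternatingL_update_smul, map_sum]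
  simp

end Piola

open MeasureTheory in
theorem hasDerivAt_integral_of_continuous_deriv {G : Type*} [TopologicalSpace G] [CompactSpace G]
    [MeasurableSpace G] [BorelSpace G] {μ : Measure G} [IsFiniteMeasure μ]
    {f f' : ℝ → G → ℝ} (hf : ∀ t, Continuous (f t)) (hf' : Continuous (Function.uncurry f'))
    (hd : ∀ t u, HasDerivAt (fun s => f s u) (f' t u) t) (t : ℝ) :
    HasDerivAt (fun s => ∫ u, f s u ∂μ) (∫ u, f' t u ∂μ) t := by
  obtain ⟨C, hC⟩ := ((isCompact_Icc (a := t - 1) (b := t + 1)).prod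
    (isCompact_univ (X := G))).exists_bound_of_continuousOn hf'.continuousOn
  refine (hasDerivAt_integral_of_dominated_loc_of_deriv_le (bound := fun _ => C)
    (Icc_mem_nhds (sub_one_lt t) (lt_add_one t)) ?_ ?_ ?_ ?_ (integrable_const C) ?_).2
  · exact Filter.Eventually.of_forall fun s =>
      (hf s).aestronglyMeasurable_of_compactSpace
  · exact (hf t).integrable_of_hasCompactSupport (HasCompactSupport.of_compactSpace _)
  · exact (hf'.comp (Continuous.prodMk_right t)).aestronglyMeasurable_of_compactSpace
  · exact Filter.Eventually.of_forall fun u s hs => hC (s, u) ⟨hs, Set.mem_univ u⟩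
  · exact Filter.Eventually.of_forall fun u s _ => hd s u

section Group
variable {A : Type*} [CStarAlgebra A]

instance unitary.instCompactSpaceOfFiniteDimensional [FiniteDimensional ℂ A] :
    CompactSpace (unitary A) := by
  have := FiniteDimensional.proper ℂ A
  refine isCompact_iff_compactSpace.1 (Metric.isCompact_of_isClosed_isBounded
    (s := (unitary A : Set A)) isClosed_unitary ?_)
  obtain _ | _ := subsingleton_or_nontrivial A
  · exact (Set.toFinite _).isBounded
  exact isBounded_iff_forall_norm_le.2 ⟨1, fun u hu => (CStarRing.norm_of_mem_unitary hu).le⟩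

theorem skewAdjoint.exp_mem_unitary (E : skewAdjoint A) (s : ℝ) :
    NormedSpace.exp (s • (E : A)) ∈ unitary A := by
  let +nondep : NormedAlgebra ℚ A := .restrictScalars ℚ ℂ A
  exact NormedSpace.exp_mem_unitary_of_mem_skewAdjoint (s • E : skewAdjoint A).2

open MeasureTheory in
theorem integral_fderiv_mul_eq_zero [FiniteDimensional ℂ A] [MeasurableSpace (unitary A)]
    [BorelSpace (unitary A)] (μ : Measure (unitary A)) [μ.IsMulLeftInvariant] [IsFiniteMeasure μ]
    {g : A → ℝ} (hg : ContDiff ℝ 1 g) (E : skewAdjoint A) :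
    ∫ u : unitary A, fderiv ℝ g u (E * u) ∂μ = 0 := by
  let e : ℝ → unitary A := fun s => ⟨_, skewAdjoint.exp_mem_unitary E s⟩
  have he : ∀ s, HasDerivAt (fun s => (e s : A)) (E * e s) s := fun s =>
    hasDerivAt_exp_smul_const' (E : A) s
  have hec : Continuous (fun s => (e s : A)) :=
    continuous_iff_continuousAt.2 fun s => (he s).continuousAt
  have key := hasDerivAt_integral_of_continuous_deriv (μ := μ)
    (f := fun s u => g (e s * u)) (f' := fun s u => fderiv ℝ g (e s * u) (E * e s * u))
    (fun s => by have := hg.continuous; fun_prop)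
    (by
      have := hg.continuous_fderiv (by simp)
      have h1 : Continuous fun x : ℝ × unitary A => (e x.1 : A) := hec.comp continuous_fst
      have h2 : Continuous fun x : ℝ × unitary A => (x.2 : A) :=
        continuous_subtype_val.comp continuous_snd
      exact (this.comp (h1.mul h2)).clm_apply ((continuous_const.mul h1).mul h2))
    (fun s u => by
      have h1 := (he s).mul_const (u : A)
      exact (hg.differentiable (by simp) _).hasFDerivAt.comp_hasDerivAt s h1) 0
  have const : (fun s => ∫ u : unitary A, g (e s * u) ∂μ) = fun _ => ∫ u : unitary A, g u ∂μ := by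
    funext s
    exact integral_mul_left_eq_self (fun u : unitary A => g u) (e s)
  rw [const] at key
  have := key.unique (hasDerivAt_const _ _)
  simpa [e] using this

end Group

section Det

theorem nonneg_of_continuous_of_ne_zero {f : ℝ → ℝ} (hf : Continuous f) (h0 : 0 < f 0)
    (hne : ∀ s, 0 ≤ s → s < 1 → f s ≠ 0) : 0 ≤ f 1 := by
  by_contra! h
  obtain ⟨s, hs, hs0⟩ := intermediate_value_Icc' zero_le_one hf.continuousOn ⟨h.le, h0.le⟩
  refine hne s hs.1 (lt_of_le_of_ne hs.2 ?_) hs0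
  rintro rfl
  exact h.ne hs0

variable {V W : Type*} [AddCommGroup V] [Module ℝ V] [FiniteDimensional ℝ V]
  [NormedAddCommGroup W] [NormedSpace ℝ W]

theorem LinearMap.continuous_det_sum_pow_smul (m : ℕ) (R : ℕ → V →ₗ[ℝ] V) :
    Continuous fun s : ℝ => LinearMap.det (∑ k ∈ Finset.range m, s ^ k • R k) := by
  let b := Module.finBasis ℝ V
  simp only [← LinearMap.det_toMatrix b, map_sum, map_smul]
  exact Continuous.matrix_det (by fun_prop)

theorem LinearMap.det_pos_of_norm_sub_lt {e : V →ₗ[ℝ] W} {T : V →ₗ[ℝ] V}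
    (hT : ∀ v ≠ 0, ‖e (T v) - e v‖ < ‖e v‖) : 0 < LinearMap.det T := by
  let R : ℕ → V →ₗ[ℝ] V := fun k => if k = 0 then 1 else T - 1
  let f : ℝ → ℝ := fun s => LinearMap.det (∑ k ∈ Finset.range 2, s ^ k • R k)
  have hfs : ∀ s, f s = LinearMap.det (1 + s • (T - 1)) := fun s => by
    simp [f, R, Finset.sum_range_succ]
  have hne : ∀ s, 0 ≤ s → s ≤ 1 → f s ≠ 0 := by
    intro s hs hs1 h
    rw [hfs] at h
    obtain ⟨v, hv, hv0⟩ := Submodule.exists_mem_ne_zero_of_ne_bot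
      (bot_lt_ker_of_det_eq_zero h).ne'
    have h1 : e v = - (s • (e (T v) - e v)) := by
      have : v + s • (T v - v) = 0 := by simpa using hv
      have := congrArg e this
      simp only [map_add, map_smul, map_sub, map_zero] at this
      exact eq_neg_of_add_eq_zero_left this
    have h2 := hT v hv0
    have h3 : ‖e v‖ = s * ‖e (T v) - e v‖ := by
      conv_lhs => rw [h1]
      rw [norm_neg, norm_smul, Real.norm_of_nonneg hs]
    nlinarith [norm_nonneg (e (T v) - e v)]
  have h1 := nonneg_of_continuous_of_ne_zero (f := f)
    (LinearMap.continuous_det_sum_pow_smul 2 R) (by simp [hfs]) fun s hs hs1 => hne s hs hs1.le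
  have h2 := hne 1 zero_le_one le_rfl
  rw [hfs] at h1 h2
  simp only [one_smul, add_sub_cancel] at h1 h2
  exact lt_of_le_of_ne h1 h2.symm

theorem LinearMap.det_geom_sum_nonneg {e : V →ₗ[ℝ] W} (he : Function.Injective e)
    {R : V →ₗ[ℝ] V} (hR : ∀ v, ‖e (R v)‖ = ‖e v‖) {m : ℕ} (hm : m ≠ 0) :
    0 ≤ LinearMap.det (∑ k ∈ Finset.range m, R ^ k) := by
  have h := nonneg_of_continuous_of_ne_zero
    (LinearMap.continuous_det_sum_pow_smul m fun k => R ^ k) ?_ ?_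
  · simpa using h
  · obtain ⟨m, rfl⟩ := Nat.exists_eq_succ_of_ne_zero hm
    simp [Finset.sum_range_succ']
  · intro s hs hs1 h
    obtain ⟨v, hv, hv0⟩ := Submodule.exists_mem_ne_zero_of_ne_bot
      (bot_lt_ker_of_det_eq_zero h).ne'
    have hpow : ∀ k, ‖e ((R ^ k) v)‖ = ‖e v‖ := by
      intro k
      induction k with
      | zero => simp
      | succ k ih => rw [pow_succ', Module.End.mul_apply, hR, ih]
    have hgeom := mul_geom_sum (s • R) m
    simp only [smul_pow] at hgeom
    have h1 : s ^ m • (R ^ m) v - v = 0 := by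
      have := LinearMap.congr_fun hgeom v
      rw [Module.End.mul_apply, LinearMap.mem_ker.1 hv, map_zero] at this
      simpa using this.symm
    have h2 : ‖e v‖ = s ^ m * ‖e v‖ := by
      have := congrArg (fun x => ‖e x‖) (sub_eq_zero.1 h1)
      simp only [map_smul, norm_smul, norm_pow, Real.norm_of_nonneg hs, hpow] at this
      exact this.symm
    have h3 : 0 < ‖e v‖ := norm_pos_iff.2 fun h0 => hv0 (he (by simpa using h0))
    have h4 := pow_lt_one₀ hs hs1 hm
    nlinarith

end Det

section Frame
variable {A : Type*} [CStarAlgebra A]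

/-- The inclusion of the skew-adjoint elements as a real linear map. -/
def skewAdjoint.subtypeₗ (A : Type*) [CStarAlgebra A] : skewAdjoint A →ₗ[ℝ] A where
  toFun x := x
  map_add' _ _ := rfl
  map_smul' _ _ := rfl

@[simp]
theorem skewAdjoint.subtypeₗ_apply (x : skewAdjoint A) : skewAdjoint.subtypeₗ A x = x := rfl

theorem skewAdjoint.subtypeₗ_injective : Function.Injective (skewAdjoint.subtypeₗ A) :=
  Subtype.val_injective

theorem norm_skewAdjointPart_le (a : A) : ‖(skewAdjointPart ℝ a : A)‖ ≤ ‖a‖ := by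
  rw [skewAdjointPart_apply_coe, norm_smul]
  have := norm_sub_le a (star a)
  rw [norm_star] at this
  simp
  linarith

/-- The linear endomorphism `Y ↦ skew part of Y * g` of the skew-adjoint elements. -/
noncomputable def skewAdjoint.mulRightPart (g : A) : skewAdjoint A →ₗ[ℝ] skewAdjoint A :=
  skewAdjointPart ℝ ∘ₗ LinearMap.mulRight ℝ g ∘ₗ skewAdjoint.subtypeₗ A

theorem skewAdjoint.mulRightPart_apply (g : A) (Y : skewAdjoint A) :
    skewAdjoint.mulRightPart g Y = skewAdjointPart ℝ (Y * g) := rfl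

variable [FiniteDimensional ℂ A]

instance skewAdjoint.instFiniteDimensional : FiniteDimensional ℝ (skewAdjoint A) :=
  have : FiniteDimensional ℝ A := FiniteDimensional.complexToReal A
  FiniteDimensional.of_injective (skewAdjoint.subtypeₗ A) skewAdjoint.subtypeₗ_injective

/-- A faithful trace provides a basis of the skew-adjoint elements whose structure constants
`c i j k` vanish as soon as two of the indices agree. -/
theorem skewAdjoint.exists_basis_commutator (τ : A →ₗ[ℝ] ℝ) (hτ : ∀ a b, τ (a * b) = τ (b * a))
    (hpos : ∀ a, a ≠ 0 → 0 < τ (star a * a)) :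
    ∃ b : Module.Basis (Fin (Module.finrank ℝ (skewAdjoint A))) ℝ (skewAdjoint A),
      ∀ j k, ∃ c : Fin (Module.finrank ℝ (skewAdjoint A)) → ℝ, c j = 0 ∧ c k = 0 ∧
        (b k * b j - b j * b k : A) = ∑ l, c l • (b l : A) := by
  let B : LinearMap.BilinForm ℝ (skewAdjoint A) :=
    LinearMap.mk₂ ℝ (fun x y => τ (x * y)) (by simp [add_mul]) (by simp) (by simp [mul_add])
      (by simp)
  have hB : LinearMap.IsSymm B := ⟨fun x y => hτ _ _⟩
  have : Invertible (2 : ℝ) := invertibleOfNonzero two_ne_zero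
  obtain ⟨b, hb⟩ := LinearMap.BilinForm.exists_orthogonal_basis (B := B) hB
  refine ⟨b, fun j k => ?_⟩
  have hmem : (b k * b j - b j * b k : A) ∈ skewAdjoint A := by
    rw [skewAdjoint.mem_iff]
    simp [skewAdjoint.mem_iff.1 (b j).2, skewAdjoint.mem_iff.1 (b k).2]
  let y : skewAdjoint A := ⟨_, hmem⟩
  have hne : ∀ l, B (b l) (b l) ≠ 0 := by
    intro l
    have h := hpos (b l) (by simpa using b.ne_zero l)
    rw [skewAdjoint.mem_iff.1 (b l).2, neg_mul, map_neg] at h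
    exact (neg_pos.1 h).ne
  have hc : ∀ l, B (b l) y = 0 → b.repr y l = 0 := by
    intro l hl
    rw [← b.sum_repr y, map_sum, Finset.sum_eq_single l] at hl
    · simpa [hne l] using hl
    · intro i _ hi
      have h0 : B (b l) (b i) = 0 := hb hi.symm
      simp [h0]
    · simp
  refine ⟨b.repr y, hc j ?_, hc k ?_, ?_⟩
  · change τ (b j * (b k * b j - b j * b k)) = 0
    rw [mul_sub, map_sub, hτ (b j) (b j * b k), mul_assoc, sub_self]
  · change τ (b k * (b k * b j - b j * b k)) = 0
    rw [mul_sub, map_sub, hτ (b k) (b k * b j), mul_assoc, sub_self]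
  · have := congrArg (skewAdjoint.subtypeₗ A) (b.sum_repr y)
    simp only [map_sum, map_smul, skewAdjoint.subtypeₗ_apply] at this
    exact this.symm

theorem skewAdjoint.det_mulRightPart_pos {g : A} (hg : ‖g - 1‖ < 1) :
    0 < LinearMap.det (skewAdjoint.mulRightPart g) := by
  refine LinearMap.det_pos_of_norm_sub_lt (e := skewAdjoint.subtypeₗ A) fun Y hY => ?_
  have hY' : 0 < ‖(Y : A)‖ := norm_pos_iff.2 (by simpa using hY)
  have h : skewAdjoint.mulRightPart g Y - Y = skewAdjointPart ℝ (Y * (g - 1) : A) := by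
    rw [mul_sub, map_sub, mul_one, skewAdjoint.mulRightPart_apply]
    congr 1
    ext
    simp [skewAdjointPart_apply_coe, skewAdjoint.mem_iff.1 Y.2, ← two_smul ℝ (Y : A)]
  rw [← map_sub, h, skewAdjoint.subtypeₗ_apply, skewAdjoint.subtypeₗ_apply]
  calc _ ≤ ‖(Y * (g - 1) : A)‖ := norm_skewAdjointPart_le _
    _ ≤ ‖(Y : A)‖ * ‖g - 1‖ := norm_mul_le _ _
    _ < _ := by nlinarith

end Frame

section Homotopy
variable {A : Type*} [CStarAlgebra A]

theorem mul_star_mem_skewAdjoint_of_hasDerivAt {c : ℝ → A} {w : A} {t : ℝ}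
    (hc : ∀ s, c s ∈ unitary A) (h : HasDerivAt c w t) : w * star (c t) ∈ skewAdjoint A := by
  have h1 := h.mul h.star
  have h2 : (c * fun s => star (c s)) = fun _ => 1 := by
    funext s
    exact (Unitary.mem_iff.1 (hc s)).2
  rw [h2] at h1
  have h3 := h1.unique (hasDerivAt_const t (1 : A))
  rw [skewAdjoint.mem_iff, star_mul, star_star]
  exact eq_neg_of_add_eq_zero_right h3

theorem exists_skewAdjoint_fderiv_eq_mul {F : ℝ × A → A} (hF : Differentiable ℝ F)
    (hU : ∀ t, ∀ u ∈ unitary A, F (t, u) ∈ unitary A) (t : ℝ) {u : A} (hu : u ∈ unitary A)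
    (r : ℝ) (E : skewAdjoint A) :
    ∃ Y : skewAdjoint A, fderiv ℝ F (t, u) (r, E * u) = Y * F (t, u) := by
  have he : HasDerivAt (fun s : ℝ => (t + s * r, NormedSpace.exp (s • (E : A)) * u))
      (r, E * u) 0 := by
    refine HasDerivAt.prodMk ?_ ?_
    · simpa using ((hasDerivAt_id (0 : ℝ)).mul_const r).const_add t
    · simpa using (hasDerivAt_exp_smul_const' (E : A) (0 : ℝ)).mul_const u
  have hc := (hF (t + 0 * r, NormedSpace.exp ((0 : ℝ) • (E : A)) * u)).hasFDerivAt.comp_hasDerivAt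
    0 he
  have := mul_star_mem_skewAdjoint_of_hasDerivAt
    (fun s => hU _ _ (mul_mem (skewAdjoint.exp_mem_unitary E s) hu)) hc
  simp only [zero_mul, add_zero, zero_smul, NormedSpace.exp_zero, one_mul]
    at this
  refine ⟨⟨_, this⟩, ?_⟩
  rw [mul_assoc, (Unitary.mem_iff.1 (hU t u hu)).1, mul_one]

/-- The right-invariant vector field on `ℝ × A` generated by a skew-adjoint element. -/
def skewAdjoint.vectorField (E : skewAdjoint A) : ℝ × A → ℝ × A := fun x => (0, E * x.2)

theorem skewAdjoint.contDiff_vectorField (E : skewAdjoint A) :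
    ContDiff ℝ ∞ (skewAdjoint.vectorField E) :=
  contDiff_const.prodMk (contDiff_const.mul contDiff_snd)

theorem skewAdjoint.hasFDerivAt_vectorField (E : skewAdjoint A) (x : ℝ × A) :
    HasFDerivAt (skewAdjoint.vectorField E)
      ((0 : ℝ × A →L[ℝ] ℝ).prod ((ContinuousLinearMap.mul ℝ A E).comp
        (ContinuousLinearMap.snd ℝ ℝ A))) x :=
  (hasFDerivAt_const 0 x).prodMk
    ((ContinuousLinearMap.mul ℝ A E).comp (ContinuousLinearMap.snd ℝ ℝ A)).hasFDerivAt

theorem skewAdjoint.lieBracket_vectorField (E E' : skewAdjoint A) (x : ℝ × A) :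
    lieBracket ℝ (skewAdjoint.vectorField E) (skewAdjoint.vectorField E') x =
      (0, (E' * E - E * E') * x.2) := by
  rw [lieBracket, (skewAdjoint.hasFDerivAt_vectorField E x).fderiv,
    (skewAdjoint.hasFDerivAt_vectorField E' x).fderiv]
  simp [skewAdjoint.vectorField, sub_mul, mul_assoc]

theorem skewAdjoint.lieBracket_const_vectorField (r : ℝ) (E : skewAdjoint A) (x : ℝ × A) :
    lieBracket ℝ (fun _ => (r, 0)) (skewAdjoint.vectorField E) x = 0 := by
  rw [lieBracket, (skewAdjoint.hasFDerivAt_vectorField E x).fderiv]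
  simp

variable [FiniteDimensional ℂ A] {ι : Type*} [Fintype ι]
  (b : Module.Basis ι ℝ (skewAdjoint A))

/-- The coordinates of the skew-adjoint part of an element. -/
noncomputable def skewAdjoint.coordL : A →L[ℝ] (ι → ℝ) :=
  have : FiniteDimensional ℝ A := FiniteDimensional.complexToReal A
  LinearMap.toContinuousLinearMap (b.equivFun.toLinearMap ∘ₗ skewAdjointPart ℝ)

theorem skewAdjoint.coordL_apply (a : A) :
    skewAdjoint.coordL b a = b.equivFun (skewAdjointPart ℝ a) := rfl

theorem skewAdjoint.exists_coordL_mul_eq {g : A} (hg : ‖g - 1‖ < 1) :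
    ∃ L : (ι → ℝ) →ₗ[ℝ] A, ∀ Y : skewAdjoint A, L (skewAdjoint.coordL b (Y * g)) = Y * g := by
  obtain ⟨K, hK⟩ := LinearMap.isUnit_iff_isUnit_det _ |>.2
    (skewAdjoint.det_mulRightPart_pos hg).ne'.isUnit
  refine ⟨LinearMap.mulRight ℝ g ∘ₗ skewAdjoint.subtypeₗ A ∘ₗ
    (↑K⁻¹ : Module.End ℝ (skewAdjoint A)) ∘ₗ b.equivFun.symm.toLinearMap, fun Y => ?_⟩
  have h1 : skewAdjointPart ℝ (Y * g : A) = (K : Module.End ℝ (skewAdjoint A)) Y := by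
    rw [hK, skewAdjoint.mulRightPart_apply]
  have h2 : (↑K⁻¹ : Module.End ℝ (skewAdjoint A)) ((K : Module.End ℝ (skewAdjoint A)) Y) = Y := by
    rw [← Module.End.mul_apply, Units.inv_mul, Module.End.one_apply]
  simp [skewAdjoint.coordL_apply, h1, h2]

variable [DecidableEq ι]

/-- The Jacobian density of a family `F` of self-maps of the unitary group. -/
noncomputable def skewAdjoint.jacobian (F : ℝ × A → A) (x : ℝ × A) : ℝ :=
  Matrix.detRowAlternatingL ι fun i =>
    fderiv ℝ (skewAdjoint.coordL b ∘ F) x (skewAdjoint.vectorField (b i) x)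

variable {F : ℝ × A → A} {φ : A → ℝ}

theorem skewAdjoint.contDiff_mul_jacobian (hF : ContDiff ℝ ∞ F) (hφ : ContDiff ℝ ∞ φ) :
    ContDiff ℝ ∞ fun x => φ (F x) * skewAdjoint.jacobian b F x :=
  ContDiff.frame_det ((skewAdjoint.coordL b).contDiff.comp hF) (hφ.comp hF)
    fun i => skewAdjoint.contDiff_vectorField (b i)

/-- The Jacobian density, cut off near the identity, changes by a divergence. -/
theorem skewAdjoint.exists_fderiv_mul_jacobian_eq_sum
    (hb : ∀ j k, ∃ c : ι → ℝ, c j = 0 ∧ c k = 0 ∧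
      (b k * b j - b j * b k : A) = ∑ l, c l • (b l : A))
    (hF : ContDiff ℝ ∞ F) (hU : ∀ t, ∀ u ∈ unitary A, F (t, u) ∈ unitary A)
    (hφ : ContDiff ℝ ∞ φ) (hφ1 : tsupport φ ⊆ Metric.ball 1 1) :
    ∃ G : ι → ℝ × A → ℝ, (∀ j, ContDiff ℝ ∞ (G j)) ∧ ∀ t, ∀ u ∈ unitary A,
      fderiv ℝ (fun x => φ (F x) * skewAdjoint.jacobian b F x) (t, u) (1, 0) =
        ∑ j, fderiv ℝ (G j) (t, u) (0, b j * u) := by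
  have hh : ContDiff ℝ ∞ (skewAdjoint.coordL b ∘ F) := (skewAdjoint.coordL b).contDiff.comp hF
  have hρ : ContDiff ℝ ∞ (φ ∘ F) := hφ.comp hF
  have hV := fun i => skewAdjoint.contDiff_vectorField (b i)
  have hT : ContDiff ℝ ∞ (fun _ : ℝ × A => ((1, 0) : ℝ × A)) := contDiff_const
  refine ⟨_, fun j => ContDiff.frame_det_update hh hρ hV hT j, fun t u hu => Eq.symm ?_⟩
  refine sum_fderiv_weight_mul_det_update_eq hh hρ hV hT (p := (t, u))
    (fun j => skewAdjoint.lieBracket_const_vectorField 1 (b j) _) (fun j k => ?_) ?_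
  · obtain ⟨c, hj, hk, hc⟩ := hb j k
    refine ⟨c, hj, hk, ?_⟩
    rw [skewAdjoint.lieBracket_vectorField, hc]
    simp [skewAdjoint.vectorField, Prod.ext_iff, Prod.fst_sum, Prod.snd_sum, Finset.sum_mul]
  · have hFd := hF.differentiable (by simp)
    have hφd := hφ.differentiable (by simp)
    have hcomp : ∀ v, fderiv ℝ (φ ∘ F) (t, u) v = fderiv ℝ φ (F (t, u)) (fderiv ℝ F (t, u) v) := by
      intro v
      rw [fderiv_comp _ (hφd _) (hFd _)]
      rfl
    have hκ : ∀ v, fderiv ℝ (skewAdjoint.coordL b ∘ F) (t, u) v =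
        skewAdjoint.coordL b (fderiv ℝ F (t, u) v) := by
      intro v
      rw [fderiv_comp _ (skewAdjoint.coordL b).differentiableAt (hFd _),
        ContinuousLinearMap.fderiv]
      rfl
    by_cases hg : F (t, u) ∈ tsupport φ
    · obtain ⟨L, hL⟩ := skewAdjoint.exists_coordL_mul_eq b (mem_ball_iff_norm.1 (hφ1 hg))
      have key : ∀ (r : ℝ) (E : skewAdjoint A), fderiv ℝ (φ ∘ F) (t, u) (r, E * u) =
          (fderiv ℝ φ (F (t, u)) ∘ₗ L)
            (fderiv ℝ (skewAdjoint.coordL b ∘ F) (t, u) (r, E * u)) := by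
        intro r E
        obtain ⟨Y, hY⟩ := exists_skewAdjoint_fderiv_eq_mul hFd hU t hu r E
        rw [hcomp, hκ, hY, LinearMap.comp_apply, hL]
        rfl
      exact ⟨_, by simpa using key 1 0, fun j => key 0 (b j)⟩
    · have h0 : fderiv ℝ φ (F (t, u)) = 0 :=
        image_eq_zero_of_notMem_tsupport fun h => hg (tsupport_fderiv_subset ℝ h)
      exact ⟨0, by simp [hcomp, h0], fun j => by simp [hcomp, h0]⟩

open MeasureTheory in
theorem skewAdjoint.integral_mul_jacobian_eq [MeasurableSpace (unitary A)]
    [BorelSpace (unitary A)] (μ : Measure (unitary A)) [μ.IsMulLeftInvariant] [IsFiniteMeasure μ]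
    (hb : ∀ j k, ∃ c : ι → ℝ, c j = 0 ∧ c k = 0 ∧
      (b k * b j - b j * b k : A) = ∑ l, c l • (b l : A))
    (hF : ContDiff ℝ ∞ F) (hU : ∀ t, ∀ u ∈ unitary A, F (t, u) ∈ unitary A)
    (hφ : ContDiff ℝ ∞ φ) (hφ1 : tsupport φ ⊆ Metric.ball 1 1) (s t : ℝ) :
    ∫ u : unitary A, φ (F (s, u)) * skewAdjoint.jacobian b F (s, u) ∂μ =
      ∫ u : unitary A, φ (F (t, u)) * skewAdjoint.jacobian b F (t, u) ∂μ := by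
  obtain ⟨G, hG, hGs⟩ := skewAdjoint.exists_fderiv_mul_jacobian_eq_sum b hb hF hU hφ hφ1
  have hI := skewAdjoint.contDiff_mul_jacobian b hF hφ
  set I := fun x => φ (F x) * skewAdjoint.jacobian b F x
  have hIc : Continuous fun x : ℝ × unitary A => fderiv ℝ I (x.1, (x.2 : A)) (1, 0) := by
    have := hI.continuous_fderiv (by simp)
    fun_prop
  have hd := hasDerivAt_integral_of_continuous_deriv (μ := μ) (f := fun t u => I (t, (u : A)))
    (f' := fun t u => fderiv ℝ I (t, (u : A)) (1, 0))
    (fun t => by have := hI.continuous; fun_prop) hIc fun t u =>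
      HasFDerivAt.comp_hasDerivAt (f := fun s => (s, (u : A))) t
        (hI.differentiable (by simp) (t, (u : A))).hasFDerivAt
        ((hasDerivAt_id t).prodMk (hasDerivAt_const t (u : A)))
  refine is_const_of_deriv_eq_zero (fun t => (hd t).differentiableAt) (fun t => ?_) s t
  have hpart : ∀ j (u : unitary A), fderiv ℝ (G j) (t, (u : A)) (0, b j * u) =
      fderiv ℝ (fun x => G j (t, x)) (u : A) (b j * u) := by
    intro j u
    have h1 : HasFDerivAt (fun x : A => (t, x)) (ContinuousLinearMap.inr ℝ ℝ A) (u : A) :=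
      hasFDerivAt_prodMk_right t (u : A)
    change _ = fderiv ℝ (G j ∘ Prod.mk t) _ _
    rw [(((hG j).differentiable (by simp) (t, (u : A))).hasFDerivAt.comp (u : A) h1).fderiv]
    simp
  have hG1 : ∀ j, ContDiff ℝ 1 fun x => G j (t, x) := fun j =>
    ((hG j).comp (contDiff_const.prodMk contDiff_id)).of_le (by simp)
  rw [(hd t).deriv]
  simp only [hGs t _ (Subtype.coe_prop _), hpart]
  rw [integral_finsetSum]
  · exact Finset.sum_eq_zero fun j _ => integral_fderiv_mul_eq_zero μ (hG1 j) (b j)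
  · intro j _
    refine Continuous.integrable_of_hasCompactSupport ?_ (HasCompactSupport.of_compactSpace _)
    have := (hG1 j).continuous_fderiv (by simp)
    fun_prop

end Homotopy

section Solve
variable {A : Type*} [CStarAlgebra A]

/-- Conjugation by an element as a linear endomorphism of the skew-adjoint elements. -/
def skewAdjoint.conjₗ (u : A) : skewAdjoint A →ₗ[ℝ] skewAdjoint A where
  toFun Y := ⟨u * Y * star u, skewAdjoint.conjugate Y.2 u⟩
  map_add' Y Z := Subtype.ext (by simp [mul_add, add_mul])
  map_smul' r Y := Subtype.ext (by simp)

@[simp]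
theorem skewAdjoint.conjₗ_apply_coe (u : A) (Y : skewAdjoint A) :
    (skewAdjoint.conjₗ u Y : A) = u * Y * star u := rfl

theorem skewAdjoint.conjₗ_pow_apply_coe (u : A) (k : ℕ) (Y : skewAdjoint A) :
    ((skewAdjoint.conjₗ u ^ k) Y : A) = u ^ k * Y * star (u ^ k) := by
  induction k with
  | zero => simp
  | succ k ih =>
    rw [pow_succ', Module.End.mul_apply, skewAdjoint.conjₗ_apply_coe, ih, pow_succ', star_mul]
    simp only [mul_assoc]

theorem hasDerivAt_exp_smul_mul_pow {u : A} (hu : u ∈ unitary A) (E : skewAdjoint A) (m : ℕ) :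
    HasDerivAt (fun s : ℝ => (NormedSpace.exp (s • (E : A)) * u) ^ m)
      (((∑ k ∈ Finset.range m, skewAdjoint.conjₗ u ^ k) E : skewAdjoint A) * u ^ m) 0 := by
  have he : HasDerivAt (fun s : ℝ => NormedSpace.exp (s • (E : A)) * u) (E * u) 0 := by
    simpa using (hasDerivAt_exp_smul_const' (E : A) (0 : ℝ)).mul_const u
  induction m with
  | zero => simpa using hasDerivAt_const (0 : ℝ) (1 : A)
  | succ m ih =>
    have h := ih.mul he
    have hum : star (u ^ m) * u ^ m = 1 := (Unitary.mem_iff.1 (pow_mem hu m)).1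
    have e : (fun s : ℝ => (NormedSpace.exp (s • (E : A)) * u) ^ (m + 1)) =
        (fun s : ℝ => (NormedSpace.exp (s • (E : A)) * u) ^ m) *
          fun s : ℝ => NormedSpace.exp (s • (E : A)) * u := funext fun s => pow_succ _ _
    rw [e]
    convert h using 1
    rw [Finset.sum_range_succ, LinearMap.add_apply, AddSubgroup.coe_add, add_mul,
      skewAdjoint.conjₗ_pow_apply_coe, pow_succ]
    congr 1
    · simp [mul_assoc]
    · simp only [zero_smul, NormedSpace.exp_zero, one_mul]
      rw [mul_assoc (u ^ m * E), ← mul_assoc (star (u ^ m)), hum, one_mul, mul_assoc]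

variable [FiniteDimensional ℂ A] {ι : Type*} [Fintype ι] [DecidableEq ι]
  (b : Module.Basis ι ℝ (skewAdjoint A)) {F : ℝ × A → A} {m : ℕ}

theorem skewAdjoint.jacobian_eq_det (hF : Differentiable ℝ F)
    (h0 : ∀ u ∈ unitary A, F (0, u) = u ^ m) {u : A} (hu : u ∈ unitary A) :
    skewAdjoint.jacobian b F (0, u) = LinearMap.det (skewAdjoint.mulRightPart (u ^ m)) *
      LinearMap.det (∑ k ∈ Finset.range m, skewAdjoint.conjₗ u ^ k) := by
  have hder : ∀ E : skewAdjoint A, fderiv ℝ F (0, u) (0, E * u) =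
      ((∑ k ∈ Finset.range m, skewAdjoint.conjₗ u ^ k) E : skewAdjoint A) * u ^ m := by
    intro E
    have he : HasDerivAt (fun s : ℝ => ((0 : ℝ), NormedSpace.exp (s • (E : A)) * u))
        (0, E * u) 0 := by
      refine (hasDerivAt_const _ _).prodMk ?_
      simpa using (hasDerivAt_exp_smul_const' (E : A) (0 : ℝ)).mul_const u
    have hc := HasFDerivAt.comp_hasDerivAt_of_eq 0 (hF (0, u)).hasFDerivAt he (by simp)
    have e : (F ∘ fun s : ℝ => ((0 : ℝ), NormedSpace.exp (s • (E : A)) * u)) =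
        fun s : ℝ => (NormedSpace.exp (s • (E : A)) * u) ^ m :=
      funext fun s => h0 _ (mul_mem (skewAdjoint.exp_mem_unitary E s) hu)
    rw [e] at hc
    exact hc.unique (hasDerivAt_exp_smul_mul_pow hu E m)
  rw [← LinearMap.det_comp, ← LinearMap.det_toMatrix b, ← Matrix.det_transpose,
    skewAdjoint.jacobian, Matrix.detRowAlternatingL_apply]
  congr 1
  ext i j
  rw [fderiv_comp _ (skewAdjoint.coordL b).differentiableAt (hF _), ContinuousLinearMap.fderiv]
  simp only [Matrix.of_apply, ContinuousLinearMap.comp_apply, skewAdjoint.vectorField, hder]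
  rw [Matrix.transpose_apply, LinearMap.toMatrix_apply, LinearMap.comp_apply,
    skewAdjoint.mulRightPart_apply, skewAdjoint.coordL_apply, Module.Basis.equivFun_apply]

theorem skewAdjoint.jacobian_nonneg (hF : Differentiable ℝ F) (hm : m ≠ 0)
    (h0 : ∀ u ∈ unitary A, F (0, u) = u ^ m) {u : A} (hu : u ∈ unitary A)
    (hu1 : ‖F (0, u) - 1‖ < 1) : 0 ≤ skewAdjoint.jacobian b F (0, u) := by
  rw [skewAdjoint.jacobian_eq_det b hF h0 hu]
  refine mul_nonneg (skewAdjoint.det_mulRightPart_pos (by rwa [← h0 u hu])).le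
    (LinearMap.det_geom_sum_nonneg skewAdjoint.subtypeₗ_injective (fun Y => ?_) hm)
  rw [skewAdjoint.subtypeₗ_apply, skewAdjoint.conjₗ_apply_coe,
    CStarRing.norm_mul_mem_unitary _ (Unitary.star_mem hu), CStarRing.norm_mem_unitary_mul _ hu,
    skewAdjoint.subtypeₗ_apply]

theorem skewAdjoint.jacobian_one_pos (hF : Differentiable ℝ F) (hm : m ≠ 0)
    (h0 : ∀ u ∈ unitary A, F (0, u) = u ^ m) : 0 < skewAdjoint.jacobian b F (0, 1) := by
  have h1 : skewAdjoint.conjₗ (1 : A) = 1 := by ext; simp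
  rw [skewAdjoint.jacobian_eq_det b hF h0 (one_mem _), h1]
  refine mul_pos (skewAdjoint.det_mulRightPart_pos (by simp)) ?_
  have : (∑ k ∈ Finset.range m, (1 : skewAdjoint A →ₗ[ℝ] skewAdjoint A) ^ k) =
      (m : ℝ) • LinearMap.id := by
    simp [← Nat.cast_smul_eq_nsmul ℝ, Module.End.one_eq_id]
  rw [this, LinearMap.det_smul, LinearMap.det_id, mul_one]
  positivity

open MeasureTheory in
/-- A smooth family of self-maps of the unitary group that starts at a nontrivial power map
ends at a map attaining the value `1`. -/
theorem exists_mem_unitary_eq_one (τ : A →ₗ[ℝ] ℝ) (hτ : ∀ a b, τ (a * b) = τ (b * a))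
    (hpos : ∀ a, a ≠ 0 → 0 < τ (star a * a)) (hF : ContDiff ℝ ∞ F)
    (hU : ∀ t, ∀ u ∈ unitary A, F (t, u) ∈ unitary A) (hm : m ≠ 0)
    (h0 : ∀ u ∈ unitary A, F (0, u) = u ^ m) : ∃ u ∈ unitary A, F (1, u) = 1 := by
  by_contra! hne
  obtain ⟨b, hb⟩ := skewAdjoint.exists_basis_commutator τ hτ hpos
  have : FiniteDimensional ℝ A := FiniteDimensional.complexToReal A
  have hFd := hF.differentiable (by simp)
  have hclosed : IsClosed (Set.range fun u : unitary A => F (1, u)) := by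
    have := hF.continuous
    exact (isCompact_range (by fun_prop)).isClosed
  obtain ⟨δ, hδ, hball⟩ := Metric.isOpen_iff.1 hclosed.isOpen_compl 1
    (by rintro ⟨u, hu⟩; exact hne u u.2 hu)
  let φ : ContDiffBump (1 : A) := ⟨min δ 1 / 4, min δ 1 / 2, by positivity, by
    have : 0 < min δ 1 := by positivity
    linarith⟩
  have hr : min δ 1 / 2 < min δ 1 := half_lt_self (by positivity)
  have hφ1 : tsupport φ ⊆ Metric.ball 1 1 := by
    rw [φ.tsupport_eq]
    exact Metric.closedBall_subset_ball (hr.trans_le (min_le_right _ _))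
  have hφδ : tsupport φ ⊆ Metric.ball 1 δ := by
    rw [φ.tsupport_eq]
    exact Metric.closedBall_subset_ball (hr.trans_le (min_le_left _ _))
  let : MeasurableSpace (unitary A) := borel _
  have : BorelSpace (unitary A) := ⟨rfl⟩
  have key := skewAdjoint.integral_mul_jacobian_eq b (Measure.haar (G := unitary A)) hb hF hU
    φ.contDiff hφ1 0 1
  have hJ1 : ∀ u : unitary A, φ (F (1, u)) = 0 := fun u =>
    image_eq_zero_of_notMem_tsupport fun h => hball (hφδ h) ⟨u, rfl⟩
  simp only [hJ1, zero_mul, integral_zero] at key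
  have hcont := (skewAdjoint.contDiff_mul_jacobian b hF φ.contDiff).continuous
  refine key.not_gt (Continuous.integral_pos_of_hasCompactSupport_nonneg_nonzero (x := 1) ?_
    (HasCompactSupport.of_compactSpace _) (fun u => ?_) ?_)
  · exact hcont.comp (g := fun x => φ (F x) * skewAdjoint.jacobian b F x)
      (f := fun u : unitary A => (0, (u : A))) (by fun_prop)
  · by_cases h : F (0, u) ∈ tsupport φ
    · exact mul_nonneg φ.nonneg
        (skewAdjoint.jacobian_nonneg b hFd hm h0 u.2 (mem_ball_iff_norm.1 (hφ1 h)))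
    · simp [image_eq_zero_of_notMem_tsupport h]
  · have h1 : φ (F (0, ((1 : unitary A) : A))) = 1 := by
      simp only [OneMemClass.coe_one, h0 1 (one_mem _), one_pow]
      exact φ.one_of_mem_closedBall (Metric.mem_closedBall_self φ.rIn_pos.le)
    rw [h1, one_mul]
    exact (skewAdjoint.jacobian_one_pos b hFd hm h0).ne'

end Solve

section Families
variable {A : Type*} [CStarAlgebra A]

/-- The families of self-maps of the unitary group that extend to smooth families of self-maps of
the ambient algebra. -/
def unitary.smoothFamilies (A : Type*) [CStarAlgebra A] :
    Subgroup (ℝ → unitary A → unitary A) where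
  carrier := {f | ∃ F : ℝ × A → A, ContDiff ℝ ∞ F ∧ ∀ t (u : unitary A), F (t, u) = f t u}
  mul_mem' := by
    rintro f g ⟨F, hF, hFf⟩ ⟨G, hG, hGg⟩
    exact ⟨fun x => F x * G x, hF.mul hG, fun t u => by simp [hFf, hGg]⟩
  one_mem' := ⟨fun _ => 1, contDiff_const, fun t u => by simp⟩
  inv_mem' := by
    rintro f ⟨F, hF, hFf⟩
    exact ⟨fun x => star (F x), (starL' ℝ : A ≃L[ℝ] A).contDiff.comp hF,
      fun t u => by simp [hFf, ← Unitary.star_eq_inv]⟩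

theorem unitary.id_mem_smoothFamilies :
    (fun _ u => u : ℝ → unitary A → unitary A) ∈ unitary.smoothFamilies A :=
  ⟨Prod.snd, contDiff_snd, fun _ _ => rfl⟩

theorem unitary.exp_mem_smoothFamilies (E : skewAdjoint A) :
    (fun t _ => ⟨_, skewAdjoint.exp_mem_unitary E t⟩ : ℝ → unitary A → unitary A) ∈
      unitary.smoothFamilies A := by
  refine ⟨fun x => NormedSpace.exp (x.1 • (E : A)), ?_, fun t u => rfl⟩
  have h : ContDiff ℝ ∞ (NormedSpace.exp : A → A) :=
    contDiff_iff_contDiffAt.2 fun x => (NormedSpace.exp_analytic (𝕂 := ℝ) x).contDiffAt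
  exact h.comp (contDiff_fst.smul contDiff_const)

theorem FreeGroup.exists_eq_of_zero_zpow (x : FreeGroup (Fin 1)) :
    ∃ k : ℤ, x = FreeGroup.of 0 ^ k := by
  induction x using FreeGroup.induction_on with
  | C1 => exact ⟨0, by simp⟩
  | of i => exact ⟨1, by simp [Subsingleton.elim i 0]⟩
  | inv_of i _ => exact ⟨-1, by simp [Subsingleton.elim i 0]⟩
  | mul x y hx hy =>
    obtain ⟨k, rfl⟩ := hx
    obtain ⟨l, rfl⟩ := hy
    exact ⟨k + l, (zpow_add _ _ _).symm⟩

variable [FiniteDimensional ℂ A]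

theorem spectrum.finite_of_finiteDimensional {K B : Type*} [Field K] [Ring B] [Algebra K B]
    [FiniteDimensional K B] (a : B) : (spectrum K a).Finite := by
  refine (Module.End.finite_spectrum (Algebra.lmul K B a)).subset fun z hz h => hz ?_
  rw [spectrum.mem_resolventSet_iff, ← Algebra.lmul_isUnit_iff (R := K), map_sub, AlgHom.commutes]
  exact h

theorem Unitary.exists_circle_norm_smul_sub_one_lt_two {u : A} (hu : u ∈ unitary A) :
    ∃ z : Circle, (z : ℂ) • u ∈ unitary A ∧ ‖(z : ℂ) • u - 1‖ < 2 := by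
  obtain ⟨θ, hθ, hθu⟩ := (Set.Ioo_infinite (neg_lt_self Real.pi_pos)).exists_notMem_finite
    ((spectrum.finite_of_finiteDimensional (K := ℂ) u).image Complex.arg)
  let z : Circle := -(Circle.exp θ)⁻¹
  have hzu : (z : ℂ) • u ∈ unitary A := by
    have hz : (starRingEnd ℂ) (z : ℂ) * z = 1 := by
      rw [← Circle.coe_inv_eq_conj, ← Circle.coe_mul, inv_mul_cancel, Circle.coe_one]
    rw [Unitary.mem_iff] at hu ⊢
    simp [smul_smul, hu.1, hu.2, hz, mul_comm (z : ℂ)]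
  refine ⟨z, hzu, (Unitary.norm_sub_one_lt_two_iff hzu).2 fun h => hθu ?_⟩
  refine ⟨Circle.exp θ, ?_, Circle.arg_exp hθ.1 hθ.2.le⟩
  have hz : (Circle.toUnits z) • ((Circle.exp θ : Circle) : ℂ) = -1 := by
    simp [z, Units.smul_def]
  rwa [← hz, show (z : ℂ) • u = Circle.toUnits z • u from rfl, spectrum.smul_mem_smul_iff] at h

theorem unitary.exists_exp_eq (u : unitary A) :
    ∃ E : skewAdjoint A, NormedSpace.exp (E : A) = u := by
  obtain ⟨z, hzu, hz⟩ := Unitary.exists_circle_norm_smul_sub_one_lt_two u.2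
  obtain ⟨θ, hθ⟩ := Circle.exp_surjective z⁻¹
  let x : selfAdjoint A := Unitary.argSelfAdjoint ⟨_, hzu⟩
  have hcomm : Commute ((θ • 1 : selfAdjoint A) : A) x := by
    simpa using (Commute.one_left (x : A)).smul_left θ
  have hexp : (selfAdjoint.expUnitary (θ • 1 : selfAdjoint A) : A) =
      algebraMap ℂ A (z⁻¹ : Circle) := by
    rw [← hθ, Circle.coe_exp, Complex.exp_eq_exp_ℂ, NormedSpace.algebraMap_exp_comm,
      selfAdjoint.expUnitary_coe]
    simp [Algebra.algebraMap_eq_smul_one, mul_comm (θ : ℂ), mul_smul, Complex.coe_smul]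
  refine ⟨⟨Complex.I • ((θ • 1 + x : selfAdjoint A) : A),
    (θ • 1 + x : selfAdjoint A).2.smul_mem_skewAdjoint Complex.conj_I⟩, ?_⟩
  rw [← selfAdjoint.expUnitary_coe, hcomm.expUnitary_add, Submonoid.coe_mul, hexp,
    expUnitary_argSelfAdjoint hz, ← Algebra.smul_def, smul_smul, ← Circle.coe_mul,
    inv_mul_cancel, Circle.coe_one, one_smul]

theorem unitary.exists_mem_smoothFamilies
    (w : Monoid.Coprod (unitary A) (FreeGroup (Fin 1))) :
    ∃ f ∈ unitary.smoothFamilies A,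
      (∀ u, f 0 u = FreeGroup.lift ![u] (contentHom₁ (unitary A) w)) ∧
        ∀ u, f 1 u = Monoid.Coprod.lift (MonoidHom.id (unitary A)) (FreeGroup.lift ![u]) w := by
  induction w using Monoid.Coprod.induction_on with
  | inl g =>
    obtain ⟨E, hE⟩ := unitary.exists_exp_eq g
    exact ⟨_, unitary.exp_mem_smoothFamilies E, fun u => Subtype.ext (by simp [contentHom₁]),
      fun u => Subtype.ext (by simp [hE])⟩
  | inr x =>
    obtain ⟨k, rfl⟩ := FreeGroup.exists_eq_of_zero_zpow x
    exact ⟨_, zpow_mem unitary.id_mem_smoothFamilies k, fun u => by simp [contentHom₁],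
      fun u => by simp⟩
  | mul x y hx hy =>
    obtain ⟨f, hf, hf0, hf1⟩ := hx
    obtain ⟨g, hg, hg0, hg1⟩ := hy
    exact ⟨f * g, mul_mem hf hg, fun u => by simp [hf0, hg0], fun u => by simp [hf1, hg1]⟩

theorem unitary.exists_eq_one_of_mem_smoothFamilies (τ : A →ₗ[ℝ] ℝ)
    (hτ : ∀ a b, τ (a * b) = τ (b * a)) (hpos : ∀ a, a ≠ 0 → 0 < τ (star a * a))
    {f : ℝ → unitary A → unitary A} (hf : f ∈ unitary.smoothFamilies A) {k : ℤ} (hk : k ≠ 0)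
    (h0 : ∀ u, f 0 u = u ^ k) : ∃ u, f 1 u = 1 := by
  wlog hk0 : 0 < k generalizing k f
  · obtain ⟨u, hu⟩ := this (inv_mem hf) (neg_ne_zero.2 hk) (fun u => by simp [h0]) (by omega)
    exact ⟨u, by simpa using hu⟩
  lift k to ℕ using hk0.le
  obtain ⟨F, hF, hFf⟩ := hf
  obtain ⟨u, hu, hu1⟩ := exists_mem_unitary_eq_one τ hτ hpos hF
    (fun t u hu => by rw [hFf t ⟨u, hu⟩]; exact (f t ⟨u, hu⟩).2) (Nat.cast_ne_zero.1 hk)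
    (fun u hu => by rw [hFf 0 ⟨u, hu⟩, h0]; simp)
  exact ⟨⟨u, hu⟩, Subtype.ext (by rw [← hFf, hu1]; rfl)⟩

/-- The unitary group of a finite-dimensional C⋆-algebra with a faithful trace is algebraically
closed with respect to one-variable equations. -/
theorem unitary.exists_lift_eq_one (τ : A →ₗ[ℝ] ℝ)
    (hτ : ∀ a b, τ (a * b) = τ (b * a)) (hpos : ∀ a, a ≠ 0 → 0 < τ (star a * a))
    (w : Monoid.Coprod (unitary A) (FreeGroup (Fin 1))) (hw : contentHom₁ (unitary A) w ≠ 1) :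
    ∃ u, Monoid.Coprod.lift (MonoidHom.id (unitary A)) (FreeGroup.lift ![u]) w = 1 := by
  obtain ⟨f, hf, hf0, hf1⟩ := unitary.exists_mem_smoothFamilies w
  obtain ⟨k, hk⟩ := FreeGroup.exists_eq_of_zero_zpow (contentHom₁ (unitary A) w)
  obtain ⟨u, hu⟩ := unitary.exists_eq_one_of_mem_smoothFamilies τ hτ hpos hf (k := k)
    (by rintro rfl; exact hw (by simpa using hk)) fun u => by simp [hf0, hk]
  exact ⟨u, by rw [← hf1, hu]⟩

end Families

/-- `U(n)` is algebraically closed with respect to one-variable equations: every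
non-singular equation in one variable with coefficients in `U(n)` has a solution
in `U(n)`. -/
theorem unitaryGroup_algebraically_closed
    (n : ℕ) (w : Monoid.Coprod (Matrix.unitaryGroup (Fin n) ℂ) (FreeGroup (Fin 1)))
    (hw : contentHom₁ (Matrix.unitaryGroup (Fin n) ℂ) w ≠ 1) :
    ∃ u : Matrix.unitaryGroup (Fin n) ℂ,
      Monoid.Coprod.lift (MonoidHom.id (Matrix.unitaryGroup (Fin n) ℂ))
        (FreeGroup.lift ![u]) w = 1 := by
  open scoped Matrix.Norms.L2Operator ComplexOrder in
  refine unitary.exists_lift_eq_one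
    (Complex.reLm ∘ₗ Matrix.traceLinearMap (Fin n) ℝ ℂ) (fun a b => ?_) (fun a ha => ?_) w hw
  · simp [Matrix.trace_mul_comm a b]
  · have h := (Matrix.posSemidef_conjTranspose_mul_self a).trace_nonneg
    have h2 : (a.conjTranspose * a).trace ≠ 0 := by
      simpa [Matrix.trace_conjTranspose_mul_self_eq_zero_iff] using ha
    exact (Complex.lt_def.1 (lt_of_le_of_ne h h2.symm)).1
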